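/- Let a, b ∈ ℝ be constants, ε₀, μ₀, c > 0 with c² = 1/(ε₀μ₀), and define the static fields of the constant charge density a and constant tangential current b on the unit circle: for p ∈ ℝ³ with ‖p‖ > 1 (off the unit circle), E(p) = (a/(4πε₀)) ∫_{-π}^{π} (p − r′(θ))/‖p − r′(θ)‖³ dθ and B(p) = (bμ₀/(4π)) ∫_{-π}^{π} (−sinθ, cosθ, 0) × (p − r′(θ))/‖p − r′(θ)‖³ dθ, where r′(θ) = (cosθ, sinθ, 0). Let P(r) denote the flux of E×B through the sphere of radius r centred at the origin. Then lim_{r→∞} P(r) = 0, i.e. the configuration satisfies the no-radiation condition. -/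

import Mathlib

open Real Filter Topology

noncomputable section

/-- Cross product in ℝ³ (represented as `ℝ × ℝ × ℝ`). -/
def cross3 (a b : ℝ × ℝ × ℝ) : ℝ × ℝ × ℝ :=
  (a.2.1 * b.2.2 - a.2.2 * b.2.1, a.2.2 * b.1 - a.1 * b.2.2, a.1 * b.2.1 - a.2.1 * b.1)

/-- Dot product in ℝ³. -/
def dot3 (a b : ℝ × ℝ × ℝ) : ℝ := a.1 * b.1 + a.2.1 * b.2.1 + a.2.2 * b.2.2

/-- Euclidean norm in ℝ³. -/
def norm3 (a : ℝ × ℝ × ℝ) : ℝ := Real.sqrt (a.1 ^ 2 + a.2.1 ^ 2 + a.2.2 ^ 2)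

/-- Flux of a vector field through the sphere of radius `r` centred at the origin. -/
def sphereFlux (V : ℝ × ℝ × ℝ → ℝ × ℝ × ℝ) (r : ℝ) : ℝ :=
  ∫ φ in (0:ℝ)..π, ∫ θ in (-π)..π,
    dot3 (V (r * (Real.sin φ * Real.cos θ), r * (Real.sin φ * Real.sin θ), r * Real.cos φ))
        (Real.sin φ * Real.cos θ, Real.sin φ * Real.sin θ, Real.cos φ)
      * r ^ 2 * Real.sin φ

end

lemma norm_le_norm3 (v : ℝ × ℝ × ℝ) : ‖v‖ ≤ norm3 v := by
  have h (x : ℝ) (hx : x ^ 2 ≤ v.1 ^ 2 + v.2.1 ^ 2 + v.2.2 ^ 2) : ‖x‖ ≤ norm3 v :=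
    Real.abs_le_sqrt hx
  refine norm_prod_le_iff.2 ⟨h _ ?_, norm_prod_le_iff.2 ⟨h _ ?_, h _ ?_⟩⟩ <;>
    nlinarith [sq_nonneg v.1, sq_nonneg v.2.1, sq_nonneg v.2.2]

lemma abs_mul_sub_mul_le {x y z w A B : ℝ} (hx : |x| ≤ A) (hz : |z| ≤ A)
    (hy : |y| ≤ B) (hw : |w| ≤ B) : |x * y - z * w| ≤ 2 * A * B := by
  have hA : 0 ≤ A := (abs_nonneg x).trans hx
  calc |x * y - z * w| ≤ |x * y| + |z * w| := abs_sub _ _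
    _ = |x| * |y| + |z| * |w| := by rw [abs_mul, abs_mul]
    _ ≤ A * B + A * B := by gcongr
    _ = 2 * A * B := by ring

lemma norm_cross3_le (u v : ℝ × ℝ × ℝ) : ‖cross3 u v‖ ≤ 2 * ‖u‖ * ‖v‖ := by
  obtain ⟨hu₁, hu⟩ := norm_prod_le_iff.1 (le_refl ‖u‖)
  obtain ⟨hu₂, hu₃⟩ := norm_prod_le_iff.1 hu
  obtain ⟨hv₁, hv⟩ := norm_prod_le_iff.1 (le_refl ‖v‖)
  obtain ⟨hv₂, hv₃⟩ := norm_prod_le_iff.1 hv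
  refine norm_prod_le_iff.2 ⟨?_, norm_prod_le_iff.2 ⟨?_, ?_⟩⟩ <;>
    apply abs_mul_sub_mul_le <;> assumption

lemma abs_dot3_le (u v : ℝ × ℝ × ℝ) : |dot3 u v| ≤ 3 * ‖u‖ * ‖v‖ := by
  obtain ⟨hu₁, hu⟩ := norm_prod_le_iff.1 (le_refl ‖u‖)
  obtain ⟨hu₂, hu₃⟩ := norm_prod_le_iff.1 hu
  obtain ⟨hv₁, hv⟩ := norm_prod_le_iff.1 (le_refl ‖v‖)
  obtain ⟨hv₂, hv₃⟩ := norm_prod_le_iff.1 hv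
  calc |dot3 u v| ≤ |u.1 * v.1| + |u.2.1 * v.2.1| + |u.2.2 * v.2.2| := abs_add_three _ _ _
    _ = ‖u.1‖ * ‖v.1‖ + ‖u.2.1‖ * ‖v.2.1‖ + ‖u.2.2‖ * ‖v.2.2‖ := by
      simp only [abs_mul, Real.norm_eq_abs]
    _ ≤ ‖u‖ * ‖v‖ + ‖u‖ * ‖v‖ + ‖u‖ * ‖v‖ := by gcongr
    _ = 3 * ‖u‖ * ‖v‖ := by ring

/-- A point at distance `r` from the origin has distance at least `r - 1` from the unit circle. -/
lemma sub_one_le_norm3_sub_circle {p : ℝ × ℝ × ℝ} {r : ℝ} (hr : 0 ≤ r)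
    (hp : p.1 ^ 2 + p.2.1 ^ 2 + p.2.2 ^ 2 = r ^ 2) (θ : ℝ) :
    r - 1 ≤ norm3 (p - (Real.cos θ, Real.sin θ, 0)) := by
  apply Real.le_sqrt_of_sq_le
  have h : p.1 * Real.cos θ + p.2.1 * Real.sin θ ≤ r := by
    refine (le_abs_self _).trans (abs_le_of_sq_le_sq ?_ hr)
    nlinarith [sq_nonneg (p.1 * Real.sin θ - p.2.1 * Real.cos θ), sq_nonneg p.2.2,
      Real.sin_sq_add_cos_sq θ]
  simp only [Prod.fst_sub, Prod.snd_sub]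
  nlinarith [Real.sin_sq_add_cos_sq θ]

/-- The Coulomb kernel of the unit circle decays quadratically. -/
lemma norm_kernel_circle_le {p : ℝ × ℝ × ℝ} {r : ℝ} (hr : 2 ≤ r)
    (hp : p.1 ^ 2 + p.2.1 ^ 2 + p.2.2 ^ 2 = r ^ 2) (θ : ℝ) :
    ‖(1 / norm3 (p - (Real.cos θ, Real.sin θ, 0)) ^ 3) • (p - (Real.cos θ, Real.sin θ, 0))‖
      ≤ 4 / r ^ 2 := by
  have hn := sub_one_le_norm3_sub_circle (by linarith) hp θ
  have hv := norm_le_norm3 (p - (Real.cos θ, Real.sin θ, 0))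
  set v := p - (Real.cos θ, Real.sin θ, 0)
  have hn₂ : r / 2 ≤ norm3 v := by linarith
  have hpos : 0 < norm3 v := by linarith
  rw [norm_smul, Real.norm_of_nonneg (by positivity)]
  calc 1 / norm3 v ^ 3 * ‖v‖ ≤ 1 / norm3 v ^ 3 * norm3 v := by gcongr
    _ = 1 / norm3 v ^ 2 := by field_simp
    _ ≤ 1 / (r / 2) ^ 2 := by gcongr
    _ = 4 / r ^ 2 := by field_simp; norm_num

lemma norm_smul_integral_circle_le {F : ℝ → ℝ × ℝ × ℝ} {C : ℝ} (k : ℝ) (hF : ∀ θ, ‖F θ‖ ≤ C) :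
    ‖k • ∫ θ in (-π)..π, F θ‖ ≤ |k| * (C * (2 * π)) := by
  rw [norm_smul, Real.norm_eq_abs]
  gcongr
  have h := intervalIntegral.norm_integral_le_of_norm_le_const (a := -π) (b := π)
    fun θ _ => hF θ
  rwa [sub_neg_eq_add, ← two_mul, abs_of_pos Real.two_pi_pos] at h

lemma norm_sphere_normal_le_one (φ θ : ℝ) :
    ‖(Real.sin φ * Real.cos θ, Real.sin φ * Real.sin θ, Real.cos φ)‖ ≤ 1 := by
  refine norm_prod_le_iff.2 ⟨?_, norm_prod_le_iff.2 ⟨?_, Real.abs_cos_le_one φ⟩⟩ <;>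
    rw [norm_mul]
  · exact mul_le_one₀ (Real.abs_sin_le_one φ) (norm_nonneg _) (Real.abs_cos_le_one θ)
  · exact mul_le_one₀ (Real.abs_sin_le_one φ) (norm_nonneg _) (Real.abs_sin_le_one θ)

lemma abs_sphereFlux_le {V : ℝ × ℝ × ℝ → ℝ × ℝ × ℝ} {r C : ℝ}
    (hV : ∀ p : ℝ × ℝ × ℝ, p.1 ^ 2 + p.2.1 ^ 2 + p.2.2 ^ 2 = r ^ 2 → ‖V p‖ ≤ C) :
    |sphereFlux V r| ≤ 3 * C * r ^ 2 * (2 * π) * π := by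
  have h₁ (φ θ : ℝ) :
      ‖dot3 (V (r * (Real.sin φ * Real.cos θ), r * (Real.sin φ * Real.sin θ), r * Real.cos φ))
        (Real.sin φ * Real.cos θ, Real.sin φ * Real.sin θ, Real.cos φ) * r ^ 2 * Real.sin φ‖
        ≤ 3 * C * r ^ 2 := by
    have hp := hV (r * (Real.sin φ * Real.cos θ), r * (Real.sin φ * Real.sin θ), r * Real.cos φ)
      (by
        linear_combination r ^ 2 * Real.sin φ ^ 2 * Real.sin_sq_add_cos_sq θ
          + r ^ 2 * Real.sin_sq_add_cos_sq φ)
    have hC : 0 ≤ C := (norm_nonneg _).trans hp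
    rw [norm_mul, norm_mul, Real.norm_of_nonneg (sq_nonneg r), Real.norm_eq_abs, Real.norm_eq_abs]
    calc _ ≤ (3 * C * 1) * r ^ 2 * 1 := by
          gcongr
          · refine (abs_dot3_le _ _).trans ?_
            gcongr
            exact norm_sphere_normal_le_one φ θ
          · exact Real.abs_sin_le_one φ
      _ = 3 * C * r ^ 2 := by ring
  have h₂ (φ : ℝ) := intervalIntegral.norm_integral_le_of_norm_le_const (a := -π) (b := π)
    fun θ _ => h₁ φ θ
  have h₃ := intervalIntegral.norm_integral_le_of_norm_le_const (a := 0) (b := π)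
    fun φ _ => h₂ φ
  rwa [sub_neg_eq_add, ← two_mul, abs_of_pos Real.two_pi_pos, sub_zero,
    abs_of_pos Real.pi_pos] at h₃

/-- the static fields of a constant charge density `a` and constant
tangential current `b` on the unit circle radiate no power at infinity. -/
theorem static_circle_fields_no_radiation
    (a b : ℝ) (ε₀ μ₀ c : ℝ) (hε₀ : 0 < ε₀) (hμ₀ : 0 < μ₀) (hc : 0 < c)
    (hc2 : c ^ 2 = 1 / (ε₀ * μ₀)) :
    let rc : ℝ → ℝ × ℝ × ℝ := fun θ => (Real.cos θ, Real.sin θ, 0)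
    let E : ℝ × ℝ × ℝ → ℝ × ℝ × ℝ := fun p =>
      (a / (4 * π * ε₀)) • ∫ θ in (-π)..π, (1 / norm3 (p - rc θ) ^ 3) • (p - rc θ)
    let B : ℝ × ℝ × ℝ → ℝ × ℝ × ℝ := fun p =>
      (b * μ₀ / (4 * π)) • ∫ θ in (-π)..π,
        cross3 (-Real.sin θ, Real.cos θ, 0) ((1 / norm3 (p - rc θ) ^ 3) • (p - rc θ))
    let P : ℝ → ℝ := fun r => sphereFlux (fun p => cross3 (E p) (B p)) r
    Filter.Tendsto P Filter.atTop (nhds 0) := by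
  intro rc E B P
  set K : ℝ := 3 * (2 * (|a / (4 * π * ε₀)| * (4 * (2 * π))) *
    (|b * μ₀ / (4 * π)| * (8 * (2 * π)))) * (2 * π) * π with hK
  have hlim : Tendsto (fun r : ℝ => K / r ^ 2) atTop (𝓝 0) :=
    tendsto_const_nhds.div_atTop (tendsto_pow_atTop two_ne_zero)
  refine squeeze_zero_norm' ?_ hlim
  filter_upwards [eventually_ge_atTop 2] with r hr
  have hr₀ : 0 < r := by linarith
  have hE (p : ℝ × ℝ × ℝ) (hp : p.1 ^ 2 + p.2.1 ^ 2 + p.2.2 ^ 2 = r ^ 2) :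
      ‖E p‖ ≤ |a / (4 * π * ε₀)| * (4 / r ^ 2 * (2 * π)) :=
    norm_smul_integral_circle_le _ (norm_kernel_circle_le hr hp)
  have hB (p : ℝ × ℝ × ℝ) (hp : p.1 ^ 2 + p.2.1 ^ 2 + p.2.2 ^ 2 = r ^ 2) :
      ‖B p‖ ≤ |b * μ₀ / (4 * π)| * (8 / r ^ 2 * (2 * π)) := by
    refine norm_smul_integral_circle_le _ fun θ => (norm_cross3_le _ _).trans ?_
    have ht : ‖((-Real.sin θ, Real.cos θ, 0) : ℝ × ℝ × ℝ)‖ ≤ 1 :=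
      norm_prod_le_iff.2 ⟨(norm_neg _).trans_le (Real.abs_sin_le_one θ),
        norm_prod_le_iff.2 ⟨Real.abs_cos_le_one θ, by simp⟩⟩
    calc _ ≤ 2 * 1 * (4 / r ^ 2) := by
          gcongr
          exact norm_kernel_circle_le hr hp θ
      _ = 8 / r ^ 2 := by ring
  have hP := abs_sphereFlux_le (V := fun p => cross3 (E p) (B p)) (r := r)
    (C := 2 * (|a / (4 * π * ε₀)| * (4 / r ^ 2 * (2 * π))) *
      (|b * μ₀ / (4 * π)| * (8 / r ^ 2 * (2 * π)))) fun p hp =>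
      (norm_cross3_le _ _).trans (by gcongr; exacts [hE p hp, hB p hp])
  refine hP.trans_eq ?_
  rw [hK]
  field_simp
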